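/- Let A = kQ/I be a locally gentle algebra with a unique maximal path γ, which is infinite. The prime (two-sided) ideals of A are exactly: (1) the zero ideal; (2) the ideal m_v for each v ∈ Q0; (3) the ideal ⟨p(m_γ)⟩ for each irreducible polynomial p(t) ∈ k[t] with deg(p) ≥ 1 and p(0) ≠ 0. -/

import Mathlib

/- Common framework for (locally) gentle algebras -/

noncomputable section
open scoped BigOperators
open CategoryTheory

namespace LocGentle

/-- A finite connected quiver with at least one vertex and one arrow. -/
structure Quiv where
  V : Type
  Arr : Type
  [fintypeV : Fintype V]
  [fintypeA : Fintype Arr]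
  [decEqV : DecidableEq V]
  [decEqA : DecidableEq Arr]
  src : Arr → V
  tgt : Arr → V
  [nonemptyV : Nonempty V]
  [nonemptyA : Nonempty Arr]
  connected : (SimpleGraph.fromRel (fun v w => ∃ a, src a = v ∧ tgt a = w)).Connected

attribute [instance] Quiv.fintypeV Quiv.fintypeA Quiv.decEqV Quiv.decEqA
  Quiv.nonemptyV Quiv.nonemptyA

variable (Q : Quiv)

/-- in-degree of a vertex -/
def indeg (v : Q.V) : ℕ := (Finset.univ.filter (fun a => Q.tgt a = v)).card

/-- out-degree of a vertex -/
def outdeg (v : Q.V) : ℕ := (Finset.univ.filter (fun a => Q.src a = v)).card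

/-- a list of arrows is composable (forms a path) -/
def Composable (l : List Q.Arr) : Prop := l.Chain' (fun a b => Q.tgt a = Q.src b)

variable {Q}

/-- source vertex of a nonempty word -/
def wSrc? (l : List Q.Arr) : Option Q.V := l.head?.map Q.src

/-- target vertex of a nonempty word -/
def wTgt? (l : List Q.Arr) : Option Q.V := l.getLast?.map Q.tgt

/-- target of a word, with a default value (used for stationary paths) -/
def wTgtD (l : List Q.Arr) (v : Q.V) : Q.V := (l.getLast?.map Q.tgt).getD v

/-- last arrow of a word, with a (junk) default -/
def wLast (l : List Q.Arr) : Q.Arr := l.getLast?.getD (Classical.arbitrary _)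

variable (rel : Q.Arr → Q.Arr → Prop)

/-- A word is allowed (is a basis path of `A = kQ/I`) if consecutive arrows are
composable and no consecutive pair lies in the relation set generating `I`. -/
def AllowedWord (l : List Q.Arr) : Prop :=
  l.Chain' (fun a b => Q.tgt a = Q.src b ∧ ¬ rel a b)

/-- right maximal paths (of positive length) -/
def RightMaxWord (l : List Q.Arr) : Prop :=
  l ≠ [] ∧ AllowedWord rel l ∧ ∀ a : Q.Arr, ¬ AllowedWord rel (l ++ [a])

/-- left maximal paths (of positive length) -/
def LeftMaxWord (l : List Q.Arr) : Prop :=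
  l ≠ [] ∧ AllowedWord rel l ∧ ∀ a : Q.Arr, ¬ AllowedWord rel (a :: l)

/-- finite maximal paths -/
def FiniteMaxWord (l : List Q.Arr) : Prop := RightMaxWord rel l ∧ LeftMaxWord rel l

/-- a word is primitive if it is not a proper power -/
def PrimitiveWord (l : List Q.Arr) : Prop :=
  ∀ (l' : List Q.Arr) (n : ℕ), 2 ≤ n → l ≠ (List.replicate n l').flatten

/-- a primitive cycle `c` with `c² ∉ I`; these represent the infinite maximal paths `c^∞`. -/
def PrimCycleSq (c : List Q.Arr) : Prop :=
  c ≠ [] ∧ AllowedWord rel (c ++ c) ∧ wTgt? c = wSrc? c ∧ PrimitiveWord c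

/-- the maximal path `γ_α` containing `α` is infinite -/
def InfThrough (a : Q.Arr) : Prop := ∃ c, PrimCycleSq rel c ∧ a ∈ c

/-- the maximal path `γ_α` containing `α` is finite -/
def FinThrough (a : Q.Arr) : Prop := ∃ l, FiniteMaxWord rel l ∧ a ∈ l

/-- the rotation of the cycle `c` starting at the arrow `a`; when `a ∈ c` and `c` has no
duplicates this is the primitive cycle `γ_r(a)`. -/
def rotTo (c : List Q.Arr) (a : Q.Arr) : List Q.Arr :=
  c.dropWhile (fun b => b != a) ++ c.takeWhile (fun b => b != a)

/-- the relation set of the Koszul dual `A#`; its allowed words are the forbidden paths of `A`. -/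
def dualRel : Q.Arr → Q.Arr → Prop := fun a b => Q.tgt a = Q.src b ∧ ¬ rel a b

/-- a forbidden path of `A`, i.e. a path of the Koszul dual `A#` -/
def ForbiddenWord (l : List Q.Arr) : Prop := AllowedWord (dualRel rel) l

variable (Q)

/-- The defining conditions (i)-(iv) of a (locally) gentle algebra, in terms of the set of
length-two relations generating the ideal `I`: an algebra satisfying them is gentle if it
is finite dimensional and locally gentle otherwise. -/
structure IsGentleRel : Prop where
  indeg_le : ∀ v : Q.V, indeg Q v ≤ 2
  outdeg_le : ∀ v : Q.V, outdeg Q v ≤ 2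
  rel_comp : ∀ a b : Q.Arr, rel a b → Q.tgt a = Q.src b
  cond_ii : ∀ a b b' : Q.Arr, b ≠ b' → Q.tgt b = Q.src a → Q.tgt b' = Q.src a →
    Xor' (rel b a) (rel b' a)
  cond_iii : ∀ a b b' : Q.Arr, b ≠ b' → Q.tgt a = Q.src b → Q.tgt a = Q.src b' →
    Xor' (rel a b) (rel a b')

/-- `Q` is (as a quiver) the extended Dynkin quiver `Ã_n` (for `n = |Q₀| - 1`):
every vertex has in-degree and out-degree one. -/
def IsAtilde : Prop := ∀ v : Q.V, indeg Q v = 1 ∧ outdeg Q v = 1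

/-- paths of `Q`, including the stationary paths (`w = []`) at each vertex -/
structure Pth where
  s : Q.V
  w : List Q.Arr
  hs : ∀ a ∈ w.head?, Q.src a = s
  hc : Composable Q w

variable {Q}

/-- target of a path -/
def Pth.t (p : Pth Q) : Q.V := wTgtD p.w p.s

/-- length of a path -/
def Pth.len (p : Pth Q) : ℕ := p.w.length

/-- a basis path of `A = kQ/I` -/
def Pth.Allowed (p : Pth Q) : Prop := AllowedWord rel p.w

end LocGentle
namespace LocGentle

variable (k : Type) [Field k] (Q : Quiv) (rel : Q.Arr → Q.Arr → Prop)

/-- The defining relations presenting `A = kQ/I` as a quotient of the free algebra on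
the stationary paths (vertices) and arrows: the path algebra relations together with
the relations `αβ = 0` for the length-two paths `αβ` generating `I`. -/
inductive GARel : FreeAlgebra k (Q.V ⊕ Q.Arr) → FreeAlgebra k (Q.V ⊕ Q.Arr) → Prop
  | idem (v : Q.V) : GARel (FreeAlgebra.ι k (Sum.inl v) * FreeAlgebra.ι k (Sum.inl v))
      (FreeAlgebra.ι k (Sum.inl v))
  | orth (v w : Q.V) : v ≠ w → GARel (FreeAlgebra.ι k (Sum.inl v) * FreeAlgebra.ι k (Sum.inl w)) 0
  | unit : GARel (∑ v : Q.V, FreeAlgebra.ι k (Sum.inl v)) 1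
  | src_mul (a : Q.Arr) : GARel (FreeAlgebra.ι k (Sum.inl (Q.src a)) * FreeAlgebra.ι k (Sum.inr a))
      (FreeAlgebra.ι k (Sum.inr a))
  | mul_tgt (a : Q.Arr) : GARel (FreeAlgebra.ι k (Sum.inr a) * FreeAlgebra.ι k (Sum.inl (Q.tgt a)))
      (FreeAlgebra.ι k (Sum.inr a))
  | src_zero (v : Q.V) (a : Q.Arr) : v ≠ Q.src a →
      GARel (FreeAlgebra.ι k (Sum.inl v) * FreeAlgebra.ι k (Sum.inr a)) 0
  | tgt_zero (v : Q.V) (a : Q.Arr) : v ≠ Q.tgt a →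
      GARel (FreeAlgebra.ι k (Sum.inr a) * FreeAlgebra.ι k (Sum.inl v)) 0
  | rel_zero (a b : Q.Arr) : rel a b →
      GARel (FreeAlgebra.ι k (Sum.inr a) * FreeAlgebra.ι k (Sum.inr b)) 0

/-- The (locally) gentle algebra `A = kQ/I`. -/
abbrev GA := RingQuot (GARel k Q rel)

/-- the image in `A` of the stationary path at `v` -/
def vtx (v : Q.V) : GA k Q rel := RingQuot.mkAlgHom k _ (FreeAlgebra.ι k (Sum.inl v))

/-- the image in `A` of the arrow `a` -/
def arr (a : Q.Arr) : GA k Q rel := RingQuot.mkAlgHom k _ (FreeAlgebra.ι k (Sum.inr a))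

/-- the image in `A` of the word `l` (the product of its arrows) -/
def wordEl (l : List Q.Arr) : GA k Q rel := (l.map (arr k Q rel)).prod

variable {Q}

/-- the image in `A` of a path (a stationary path maps to the corresponding idempotent) -/
def Pth.el (p : Pth Q) : GA k Q rel := vtx k Q rel p.s * wordEl k Q rel p.w

variable (Q)

/-- the `n`-th graded component `A_n` of `A`, spanned by the images of paths of length `n` -/
def deg (n : ℕ) : Submodule k (GA k Q rel) :=
  Submodule.span k {x | ∃ p : Pth Q, p.Allowed rel ∧ p.len = n ∧ x = p.el k rel}

/-- the augmentation ideal `A₊` (as a `k`-submodule), spanned by paths of positive length -/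
def degPlus : Submodule k (GA k Q rel) :=
  Submodule.span k {x | ∃ p : Pth Q, p.Allowed rel ∧ 1 ≤ p.len ∧ x = p.el k rel}

/-- the Hilbert series of `A` (with integer coefficients) -/
def hilb : PowerSeries ℤ :=
  PowerSeries.mk fun n => (Module.finrank k (deg k Q rel n) : ℤ)

/-- the Hilbert series of `A` (with rational coefficients) -/
def hilbQ : PowerSeries ℚ :=
  PowerSeries.mk fun n => (Module.finrank k (deg k Q rel n) : ℚ)

/-- the number `k_n` of finite maximal paths of length at least `n` -/
def numFMP (n : ℕ) : ℕ := {l : List Q.Arr | FiniteMaxWord rel l ∧ n ≤ l.length}.ncard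

/-- the Gelfand-Kirillov dimension of `A`:
`limsup_n log (dim_k A_{≤ n}) / log n`. -/
def GKdim : ℝ :=
  Filter.limsup (fun n : ℕ =>
      Real.log (Module.finrank k ↥(⨆ i ∈ Finset.range (n + 1), deg k Q rel i)) / Real.log n)
    Filter.atTop

/-- the central element `m_γ` attached to the infinite maximal path `γ = c^∞`:
the sum over the arrows `α` of `c` of the primitive cycle `γ_r(α)` starting at `α`. -/
def mEl (c : List Q.Arr) : GA k Q rel := (c.map fun a => wordEl k Q rel (rotTo c a)).sum

/-- evaluation of a polynomial at `x ∈ A`; `polyEval k Q rel p x` is `p(x)`. -/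
def polyEval (p : Polynomial k) (x : GA k Q rel) : GA k Q rel :=
  Polynomial.eval₂ (algebraMap k (GA k Q rel)) x p

end LocGentle
namespace LocGentle

variable (k : Type) [Field k] (Q : Quiv) (rel : Q.Arr → Q.Arr → Prop)

/-! ### Two-sided ideals and primes -/

/-- a prime (two-sided) ideal -/
def IsPrimeTI (P : TwoSidedIdeal (GA k Q rel)) : Prop :=
  P ≠ ⊤ ∧ ∀ x y : GA k Q rel, (∀ a : GA k Q rel, x * a * y ∈ P) → x ∈ P ∨ y ∈ P

/-- the maximal ideal `𝔪_v` of `A` which does not contain `ε_v`: it is generated by the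
stationary paths at the other vertices together with all loops at `v`. -/
def mIdeal (v : Q.V) : TwoSidedIdeal (GA k Q rel) :=
  TwoSidedIdeal.span
    ({x | ∃ w : Q.V, w ≠ v ∧ x = vtx k Q rel w} ∪
     {x | ∃ a : Q.Arr, Q.src a = v ∧ Q.tgt a = v ∧ x = arr k Q rel a})

/-- the ideal `J_γ` corresponding to the infinite maximal path `γ = c^∞`, generated by
all arrows lying on `γ` -/
def Jgamma (c : List Q.Arr) : TwoSidedIdeal (GA k Q rel) :=
  TwoSidedIdeal.span {x | ∃ a ∈ c, x = arr k Q rel a}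

/-- the left annihilator of `J_γ` -/
def annJ (c : List Q.Arr) : Set (GA k Q rel) :=
  {x | ∀ y ∈ Jgamma k Q rel c, x * y = 0}

/-! ### The simple modules `S(v)`, and `Ext` groups -/

/-- the algebra map `A → k` corresponding to the vertex `v` (projection onto the
coefficient of `ε_v`) -/
def vtxHomAux (v : Q.V) : FreeAlgebra k (Q.V ⊕ Q.Arr) →ₐ[k] k :=
  FreeAlgebra.lift k (Sum.elim (fun w => if w = v then (1 : k) else 0) (fun _ => 0))

theorem vtxHomAux_rel (v : Q.V) : ∀ ⦃x y⦄, GARel k Q rel x y →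
    vtxHomAux k Q v x = vtxHomAux k Q v y := by
  intro x y h
  cases h with
  | idem w =>
      simp only [vtxHomAux, map_mul, FreeAlgebra.lift_ι_apply, Sum.elim_inl]
      split_ifs <;> simp
  | orth w w' hne =>
      simp only [vtxHomAux, map_mul, FreeAlgebra.lift_ι_apply, Sum.elim_inl, map_zero]
      split_ifs with h1 h2 <;> first | (exact absurd (h1.trans h2.symm) hne) | simp
  | unit =>
      simp only [vtxHomAux, map_sum, FreeAlgebra.lift_ι_apply, Sum.elim_inl, map_one]
      simp [Finset.sum_ite_eq' Finset.univ v (fun _ => (1:k))]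
  | src_mul a =>
      simp [vtxHomAux, map_mul, FreeAlgebra.lift_ι_apply]
  | mul_tgt a =>
      simp [vtxHomAux, map_mul, FreeAlgebra.lift_ι_apply]
  | src_zero w a hw =>
      simp [vtxHomAux, map_mul, FreeAlgebra.lift_ι_apply]
  | tgt_zero w a hw =>
      simp [vtxHomAux, map_mul, FreeAlgebra.lift_ι_apply]
  | rel_zero a b hab =>
      simp [vtxHomAux, map_mul, FreeAlgebra.lift_ι_apply]

/-- the ring map `A → k` corresponding to the vertex `v` -/
def vtxHom (v : Q.V) : GA k Q rel →+* k :=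
  RingQuot.lift ⟨(vtxHomAux k Q v).toRingHom, fun _ _ h => vtxHomAux_rel k Q rel v h⟩

/-- the ring map `A → k^{Q₀}` with kernel `A₊` -/
def SHom : GA k Q rel →+* (Q.V → k) := Pi.ringHom fun v => vtxHom k Q rel v

/-- the graded simple right `A`-module `S(v)` at the vertex `v` -/
def SvModR (v : Q.V) : ModuleCat (GA k Q rel)ᵐᵒᵖ :=
  @ModuleCat.of _ _ k _
    (Module.compHom k ((vtxHom k Q rel v).fromOpposite (fun _ _ => mul_comm _ _)))

/-- the graded simple left `A`-module `S(v)` at the vertex `v` -/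
def SvModL (v : Q.V) : ModuleCat (GA k Q rel) :=
  @ModuleCat.of _ _ k _ (Module.compHom k (vtxHom k Q rel v))

/-- `S = A/A₊ ≅ ⊕_v S(v)` as a right `A`-module -/
def SModR : ModuleCat (GA k Q rel)ᵐᵒᵖ :=
  @ModuleCat.of _ _ (Q.V → k) _
    (Module.compHom _ ((SHom k Q rel).fromOpposite (fun _ _ => mul_comm _ _)))

/-- `S = A/A₊` as a left `A`-module -/
def SModL : ModuleCat (GA k Q rel) :=
  @ModuleCat.of _ _ (Q.V → k) _ (Module.compHom _ (SHom k Q rel))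

/-- `A` as a right module over itself -/
def AModR : ModuleCat (GA k Q rel)ᵐᵒᵖ := ModuleCat.of _ (GA k Q rel)

/-- `A` as a left module over itself -/
def AModL : ModuleCat (GA k Q rel) := ModuleCat.of _ (GA k Q rel)

/-- nonvanishing of `Ext^i(M, N)` for modules over a ring `R` -/
def extNZ {R : Type} [Ring R] (i : ℕ) (M N : ModuleCat R) : Prop :=
  ¬ Subsingleton (((Ext ℤ (ModuleCat R) i).obj (Opposite.op M)).obj N)

/-- nonvanishing of `Ext^i_A(S(v), A)` in right `A`-modules.  (For the Noetherian graded
algebra `A` with the finitely generated modules `S(v)` and `A` this agrees with the graded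
`Ext`-group, summed over all shifts, used in the paper.) -/
def extSvNZ (i : ℕ) (v : Q.V) : Prop := extNZ i (SvModR k Q rel v) (AModR k Q rel)

/-- nonvanishing of `Ext^i_A(S, A)` in right `A`-modules -/
def extSNZ (i : ℕ) : Prop := extNZ i (SModR k Q rel) (AModR k Q rel)

/-- the depth of `A`: `min { i : Ext^i_A(S, A) ≠ 0 }` -/
def depth : ℕ∞ := sInf {n : ℕ∞ | ∃ i : ℕ, n = i ∧ extSNZ k Q rel i}

/-- the right self-injective dimension of `A`:
`sup { i : Ext^i(M, A) ≠ 0 for some right module M }` -/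
def rInjDim : ℕ∞ :=
  sSup {n : ℕ∞ | ∃ (i : ℕ) (M : ModuleCat.{0} (GA k Q rel)ᵐᵒᵖ), n = i ∧ extNZ i M (AModR k Q rel)}

/-- the left self-injective dimension of `A` -/
def lInjDim : ℕ∞ :=
  sSup {n : ℕ∞ | ∃ (i : ℕ) (M : ModuleCat.{0} (GA k Q rel)), n = i ∧ extNZ i M (AModL k Q rel)}

/-- the right global dimension of `A`: `sup { i : Ext^i(M, N) ≠ 0 }` over right modules -/
def rGlDim : ℕ∞ :=
  sSup {n : ℕ∞ | ∃ (i : ℕ) (M N : ModuleCat.{0} (GA k Q rel)ᵐᵒᵖ), n = i ∧ extNZ i M N}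

/-- the left global dimension of `A` -/
def lGlDim : ℕ∞ :=
  sSup {n : ℕ∞ | ∃ (i : ℕ) (M N : ModuleCat.{0} (GA k Q rel)), n = i ∧ extNZ i M N}

end LocGentle
namespace LocGentle

/-! ### Prime ideals of orders in a matrix ring over `k[X]` -/

section MatrixOrder

open Polynomial

variable {k A ι : Type*} [Field k] [Ring A] [Algebra k A] [Fintype ι] [DecidableEq ι]

/-- A `k`-algebra `A` embedded in the matrix ring over `k[X]` so that `m` becomes the scalar
matrix `X` and the image of `A` contains all multiples of `X`. -/
structure IsMatrixOrder (Φ : A →ₐ[k] Matrix ι ι k[X]) (m : A) : Prop where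
  injective : Function.Injective Φ
  map_eq : Φ m = algebraMap k[X] (Matrix ι ι k[X]) X
  exists_preimage : ∀ M : Matrix ι ι k[X], ∃ y, Φ y = (X : k[X]) • M

namespace IsMatrixOrder

variable {Φ : A →ₐ[k] Matrix ι ι k[X]} {m : A}

theorem map_aeval (h : IsMatrixOrder Φ m) (f : k[X]) :
    Φ (aeval m f) = algebraMap k[X] (Matrix ι ι k[X]) f := by
  rw [← aeval_algHom_apply, h.map_eq, aeval_algebraMap_apply, aeval_X_left_apply]

theorem map_aeval_mul_apply (h : IsMatrixOrder Φ m) (f : k[X]) (x : A) (i j : ι) :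
    Φ (aeval m f * x) i j = f * Φ x i j := by
  rw [map_mul, h.map_aeval, ← Algebra.smul_def, Matrix.smul_apply, smul_eq_mul]

theorem aeval_comm (h : IsMatrixOrder Φ m) (f : k[X]) (x : A) :
    aeval m f * x = x * aeval m f := by
  apply h.injective
  rw [map_mul, map_mul, h.map_aeval, Algebra.commutes]

theorem exists_apply_ne_zero (h : IsMatrixOrder Φ m) {x : A} (hx : x ≠ 0) :
    ∃ i j, Φ x i j ≠ 0 := by
  by_contra! h0
  exact hx (h.injective (by ext1 i j; simp [h0 i j]))

/-- A weighted matrix unit in `A` carries the `(i, j)` entry of `x` and the `(r, s)` entry of `y`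
to an entry of a product `x * a * y`. -/
theorem exists_mul_mul_apply (h : IsMatrixOrder Φ m) (j r : ι) :
    ∃ a, ∀ x y i s, Φ (x * a * y) i s = X * (Φ x i j * Φ y r s) := by
  obtain ⟨a, ha⟩ := h.exists_preimage (Matrix.single j r 1)
  refine ⟨a, fun x y i s => ?_⟩
  rw [map_mul, map_mul, ha, Matrix.mul_smul, Matrix.smul_mul, Matrix.smul_apply, smul_eq_mul,
    Matrix.mul_assoc, Matrix.mul_apply, Finset.sum_eq_single j]
  · simp
  · intro b _ hb
    rw [Matrix.single_mul_apply_of_ne _ _ _ _ _ hb, mul_zero]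
  · simp

theorem bot_ne_top (Φ : A →ₐ[k] Matrix ι ι k[X]) [Nonempty ι] :
    (⊥ : TwoSidedIdeal A) ≠ ⊤ := by
  intro h1
  have h2 : (1 : A) ∈ (⊥ : TwoSidedIdeal A) := h1 ▸ trivial
  have h3 : (1 : A) = 0 := h2
  have h4 := congrArg Φ h3
  rw [map_one, map_zero] at h4
  exact one_ne_zero h4

theorem bot_prime (h : IsMatrixOrder Φ m) {x y : A}
    (hxy : ∀ a, x * a * y ∈ (⊥ : TwoSidedIdeal A)) :
    x ∈ (⊥ : TwoSidedIdeal A) ∨ y ∈ (⊥ : TwoSidedIdeal A) := by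
  by_contra! hne
  obtain ⟨i, j, hij⟩ := h.exists_apply_ne_zero (x := x) hne.1
  obtain ⟨r, s, hrs⟩ := h.exists_apply_ne_zero (x := y) hne.2
  obtain ⟨a, ha⟩ := h.exists_mul_mul_apply j r
  have h0 : x * a * y = 0 := hxy a
  have := ha x y i s
  rw [h0, map_zero] at this
  exact mul_ne_zero X_ne_zero (mul_ne_zero hij hrs) this.symm

theorem mem_span_aeval_iff (h : IsMatrixOrder Φ m) {p : k[X]} (hp : p.coeff 0 ≠ 0) (x : A) :
    x ∈ TwoSidedIdeal.span {aeval m p} ↔ ∀ i j, p ∣ Φ x i j := by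
  constructor
  · intro hx
    let Ψ : A →+* Matrix ι ι (k[X] ⧸ Ideal.span {p}) :=
      (Ideal.Quotient.mk (Ideal.span {p})).mapMatrix.comp (Φ : A →+* Matrix ι ι k[X])
    have hΨ : ∀ y, y ∈ TwoSidedIdeal.ker Ψ ↔ ∀ i j, p ∣ Φ y i j := by
      intro y
      rw [TwoSidedIdeal.mem_ker, ← Matrix.ext_iff]
      simp only [← Ideal.mem_span_singleton, ← Ideal.Quotient.eq_zero_iff_mem]
      rfl
    refine (hΨ x).1 (TwoSidedIdeal.span_le.2 ?_ hx)
    rintro _ rfl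
    refine (hΨ _).2 fun i j => ?_
    rw [h.map_aeval, Matrix.algebraMap_matrix_apply]
    split_ifs <;> simp
  · intro hx
    choose f hf using hx
    obtain ⟨y, hy⟩ := h.exists_preimage (Matrix.of f)
    have hmx : m * x = aeval m p * y := by
      apply h.injective
      ext1 i j
      have h1 := h.map_aeval_mul_apply X x i j
      rw [aeval_X] at h1
      rw [h1, h.map_aeval_mul_apply, hy, hf, Matrix.smul_apply, Matrix.of_apply, smul_eq_mul]
      ring
    have hmem : aeval m p ∈ TwoSidedIdeal.span {aeval m p} := TwoSidedIdeal.subset_span rfl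
    have hm : m * x ∈ TwoSidedIdeal.span {aeval m p} :=
      hmx ▸ TwoSidedIdeal.mul_mem_right _ _ _ hmem
    have hdecomp : algebraMap k A (p.coeff 0) * x
        = aeval m p * x - aeval m p.divX * (m * x) := by
      have : aeval m p = aeval m p.divX * m + algebraMap k A (p.coeff 0) := by
        conv_lhs => rw [← divX_mul_X_add p]
        simp
      rw [this]
      noncomm_ring
    have hmem' : algebraMap k A (p.coeff 0) * x ∈ TwoSidedIdeal.span {aeval m p} := by
      rw [hdecomp]
      exact TwoSidedIdeal.sub_mem _ (TwoSidedIdeal.mul_mem_right _ _ _ hmem)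
        (TwoSidedIdeal.mul_mem_left _ _ _ hm)
    have := TwoSidedIdeal.mul_mem_left _ (algebraMap k A (p.coeff 0)⁻¹) _ hmem'
    rwa [← mul_assoc, ← map_mul, inv_mul_cancel₀ hp, map_one, one_mul] at this

theorem span_aeval_ne_top (h : IsMatrixOrder Φ m) [Nonempty ι] {p : k[X]} (hirr : Irreducible p)
    (hp : p.coeff 0 ≠ 0) : TwoSidedIdeal.span {aeval m p} ≠ ⊤ := by
  intro htop
  have h1 : (1 : A) ∈ TwoSidedIdeal.span {aeval m p} := htop ▸ trivial
  let i : ι := Classical.arbitrary ι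
  have := (h.mem_span_aeval_iff hp 1).1 h1 i i
  rw [map_one, Matrix.one_apply_eq] at this
  exact hirr.not_isUnit (isUnit_of_dvd_one this)

theorem span_aeval_prime (h : IsMatrixOrder Φ m) {p : k[X]} (hirr : Irreducible p)
    (hp : p.coeff 0 ≠ 0) {x y : A}
    (hxy : ∀ a, x * a * y ∈ TwoSidedIdeal.span {aeval m p}) :
    x ∈ TwoSidedIdeal.span {aeval m p} ∨ y ∈ TwoSidedIdeal.span {aeval m p} := by
  simp only [h.mem_span_aeval_iff hp] at hxy ⊢
  by_contra! hne
  obtain ⟨⟨i, j, hij⟩, r, s, hrs⟩ := hne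
  obtain ⟨a, ha⟩ := h.exists_mul_mul_apply j r
  have hdvd := hxy a i s
  rw [ha] at hdvd
  rcases hirr.prime.dvd_or_dvd hdvd with hX | hdvd
  · exact hp (X_dvd_iff.1 ((hirr.dvd_symm irreducible_X hX)))
  · exact (hirr.prime.dvd_or_dvd hdvd).elim hij hrs

variable {P : TwoSidedIdeal A}

theorem mem_of_aeval_mul_mem (h : IsMatrixOrder Φ m)
    (hP : ∀ x y, (∀ a, x * a * y ∈ P) → x ∈ P ∨ y ∈ P) (f : k[X]) {x : A}
    (hx : aeval m f * x ∈ P) : aeval m f ∈ P ∨ x ∈ P := by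
  refine hP _ _ fun a => ?_
  rw [h.aeval_comm, mul_assoc]
  exact P.mul_mem_left _ _ hx

theorem aeval_apply_mem (h : IsMatrixOrder Φ m)
    (hP : ∀ x y, (∀ a, x * a * y ∈ P) → x ∈ P ∨ y ∈ P) (hm : m ∉ P) {x : A} (hx : x ∈ P)
    (i j : ι) : aeval m (Φ x i j) ∈ P := by
  choose u hu using fun r => h.exists_preimage (Matrix.single r i 1)
  choose w hw using fun r => h.exists_preimage (Matrix.single j r 1)
  have hsum : ∑ r, u r * x * w r =
      aeval m (X : k[X]) * (aeval m (X : k[X]) * aeval m (Φ x i j)) := by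
    apply h.injective
    simp only [map_sum, map_mul, hu, hw, h.map_aeval, Matrix.smul_mul, Matrix.mul_smul,
      Matrix.single_mul_mul_single, one_mul, mul_one, Algebra.algebraMap_eq_smul_one]
    rw [← Finset.smul_sum, ← Finset.smul_sum, Matrix.sum_single_eq_diagonal (fun _ => Φ x i j),
      ← Matrix.smul_one_eq_diagonal]
    simp only [smul_smul]
    congr 1
    ring
  have hmem : aeval m (X : k[X]) * (aeval m (X : k[X]) * aeval m (Φ x i j)) ∈ P := by
    rw [← hsum]
    exact TwoSidedIdeal.finsetSum_mem _ _ _ fun r _ =>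
      P.mul_mem_right _ _ (P.mul_mem_left _ _ hx)
  have hX : aeval m (X : k[X]) ∉ P := by rwa [aeval_X]
  have h1 := (h.mem_of_aeval_mul_mem hP X hmem).resolve_left hX
  exact (h.mem_of_aeval_mul_mem hP X h1).resolve_left hX

theorem exists_eq_span_aeval (h : IsMatrixOrder Φ m) (htop : P ≠ ⊤)
    (hP : ∀ x y, (∀ a, x * a * y ∈ P) → x ∈ P ∨ y ∈ P) (hm : m ∉ P) (hbot : P ≠ ⊥) :
    ∃ p : k[X], Irreducible p ∧ 1 ≤ p.natDegree ∧ p.coeff 0 ≠ 0 ∧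
      P = TwoSidedIdeal.span {aeval m p} := by
  let I : Ideal k[X] :=
    { carrier := {f | aeval m f ∈ P}
      add_mem' := fun {f g} hf hg => by
        change aeval m (f + g) ∈ P
        rw [map_add]
        exact P.add_mem hf hg
      zero_mem' := by
        change aeval m 0 ∈ P
        rw [map_zero]
        exact P.zero_mem
      smul_mem' := fun f g hg => by
        change aeval m (f * g) ∈ P
        rw [map_mul]
        exact P.mul_mem_left _ _ hg }
  have hI : ∀ f, f ∈ I ↔ aeval m f ∈ P := fun f => Iff.rfl
  have hIprime : I.IsPrime := by
    refine ⟨fun h1 => htop ((TwoSidedIdeal.one_mem_iff P).1 ?_), fun {f g} hfg => ?_⟩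
    · have : (1 : k[X]) ∈ I := h1 ▸ trivial
      rwa [hI, map_one] at this
    · rw [hI, map_mul] at hfg
      exact h.mem_of_aeval_mul_mem hP f hfg
  have hIbot : I ≠ ⊥ := by
    intro hI0
    refine hbot (le_bot_iff.1 fun x hx => ?_)
    by_contra hx0
    obtain ⟨i, j, hij⟩ := h.exists_apply_ne_zero (x := x) hx0
    have : Φ x i j ∈ I := h.aeval_apply_mem hP hm hx i j
    rw [hI0] at this
    exact hij this
  have hgen : ∀ f, f ∈ I ↔ Submodule.IsPrincipal.generator I ∣ f := fun f =>
    Submodule.IsPrincipal.mem_iff_generator_dvd I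
  have hprime := Submodule.IsPrincipal.prime_generator_of_isPrime I hIbot
  have hcoeff : (Submodule.IsPrincipal.generator I).coeff 0 ≠ 0 := by
    intro h0
    have : Submodule.IsPrincipal.generator I ∣ X :=
      irreducible_X.dvd_symm hprime.irreducible (X_dvd_iff.2 h0)
    rw [← hgen, hI, aeval_X] at this
    exact hm this
  refine ⟨_, hprime.irreducible, hprime.irreducible.natDegree_pos, hcoeff, le_antisymm ?_ ?_⟩
  · intro x hx
    rw [h.mem_span_aeval_iff hcoeff]
    exact fun i j => (hgen _).1 (h.aeval_apply_mem hP hm hx i j)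
  · rw [TwoSidedIdeal.span_le]
    rintro _ rfl
    exact (hgen _).2 dvd_rfl

/-- A prime ideal containing `m` contains every element whose image is divisible by `X`. -/
theorem mem_of_X_dvd (h : IsMatrixOrder Φ m)
    (hP : ∀ x y, (∀ a, x * a * y ∈ P) → x ∈ P ∨ y ∈ P) (hm : m ∈ P) {x : A}
    (hx : ∀ i j, X ∣ Φ x i j) : x ∈ P := by
  choose f hf using hx
  have hfx : Φ x = (X : k[X]) • Matrix.of f := by
    ext1 i j
    simp [hf]
  refine or_self_iff.1 (hP x x fun a => ?_)
  obtain ⟨y, hy⟩ := h.exists_preimage (Matrix.of f * Φ a * Matrix.of f)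
  have : x * a * x = m * y := by
    apply h.injective
    simp only [map_mul, hy, hfx, h.map_eq, Matrix.smul_mul, Matrix.mul_smul, ← Algebra.smul_def]
  rw [this]
  exact P.mul_mem_right _ _ hm

end IsMatrixOrder

end MatrixOrder

/-! ### Cyclic orderings of the arrows -/

/-- An `n`-periodic enumeration of all the arrows in which each arrow is followed by the only
arrow with which it has a nonzero product. -/
structure CyclicOrdering {Q : Quiv} (rel : Q.Arr → Q.Arr → Prop) (n : ℕ) where
  F : ℕ → Q.Arr
  periodic : Function.Periodic F n
  injOn : ∀ i j, i < n → j < n → F i = F j → i = j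
  surj : ∀ a, ∃ i, i < n ∧ F i = a
  tgt_eq : ∀ i, Q.tgt (F i) = Q.src (F (i + 1))
  not_rel : ∀ i, ¬ rel (F i) (F (i + 1))
  rel_of_ne : ∀ i b, Q.tgt (F i) = Q.src b → b ≠ F (i + 1) → rel (F i) b

namespace CyclicOrdering

variable {k : Type} [Field k] {Q : Quiv} {rel : Q.Arr → Q.Arr → Prop} {n : ℕ}
  (o : CyclicOrdering rel n)

/-- the position of an arrow in a cyclic ordering -/
def idx (a : Q.Arr) : ℕ := (o.surj a).choose

theorem idx_lt (a : Q.Arr) : o.idx a < n := (o.surj a).choose_spec.1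

theorem F_idx (a : Q.Arr) : o.F (o.idx a) = a := (o.surj a).choose_spec.2

theorem F_mod (i : ℕ) : o.F (i % n) = o.F i := o.periodic.map_mod_nat i

theorem idx_F [NeZero n] (i : ℕ) : o.idx (o.F i) = i % n :=
  o.injOn _ _ (o.idx_lt _) (Nat.mod_lt _ (NeZero.pos n)) (by rw [o.F_idx, o.F_mod])

theorem exists_src_eq (o : CyclicOrdering rel n) (v : Q.V) : ∃ a, Q.src a = v := by
  by_cases hV : Nontrivial Q.V
  · obtain ⟨u, hu⟩ := Q.connected.preconnected.exists_adj_of_nontrivial v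
    rw [SimpleGraph.fromRel_adj] at hu
    rcases hu.2 with ⟨a, ha, -⟩ | ⟨a, -, ha⟩
    · exact ⟨a, ha⟩
    · exact ⟨o.F (o.idx a + 1), by rw [← o.tgt_eq, o.F_idx, ha]⟩
  · rw [not_nontrivial_iff_subsingleton] at hV
    exact ⟨Classical.arbitrary _, Subsingleton.elim _ _⟩

/-- a chosen arrow starting at a vertex -/
def out (v : Q.V) : Q.Arr := (o.exists_src_eq v).choose

theorem src_out (v : Q.V) : Q.src (o.out v) = v := (o.exists_src_eq v).choose_spec

end CyclicOrdering

section Relations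

variable (k : Type) [Field k] (Q : Quiv) (rel : Q.Arr → Q.Arr → Prop)

theorem vtx_mul_vtx (v w : Q.V) :
    vtx k Q rel v * vtx k Q rel w = if v = w then vtx k Q rel v else 0 := by
  split_ifs with h
  · subst h
    simpa only [vtx, arr, map_mul] using RingQuot.mkAlgHom_rel k (GARel.idem (k := k) (rel := rel) v)
  · simpa only [vtx, arr, map_mul, map_zero] using
      RingQuot.mkAlgHom_rel k (GARel.orth (k := k) (rel := rel) v w h)

theorem sum_vtx : ∑ v, vtx k Q rel v = 1 := by
  simpa only [vtx, map_sum, map_one] using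
    RingQuot.mkAlgHom_rel k (GARel.unit (k := k) (rel := rel))

theorem vtx_mul_arr (v : Q.V) (a : Q.Arr) :
    vtx k Q rel v * arr k Q rel a = if v = Q.src a then arr k Q rel a else 0 := by
  split_ifs with h
  · subst h
    simpa only [vtx, arr, map_mul] using RingQuot.mkAlgHom_rel k (GARel.src_mul (k := k) (rel := rel) a)
  · simpa only [vtx, arr, map_mul, map_zero] using
      RingQuot.mkAlgHom_rel k (GARel.src_zero (k := k) (rel := rel) v a h)

theorem arr_mul_vtx (v : Q.V) (a : Q.Arr) :
    arr k Q rel a * vtx k Q rel v = if v = Q.tgt a then arr k Q rel a else 0 := by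
  split_ifs with h
  · subst h
    simpa only [vtx, arr, map_mul] using RingQuot.mkAlgHom_rel k (GARel.mul_tgt (k := k) (rel := rel) a)
  · simpa only [vtx, arr, map_mul, map_zero] using
      RingQuot.mkAlgHom_rel k (GARel.tgt_zero (k := k) (rel := rel) v a h)

theorem arr_mul_arr_of_rel {a b : Q.Arr} (h : rel a b) :
    arr k Q rel a * arr k Q rel b = 0 := by
  simpa only [vtx, arr, map_mul, map_zero] using
    RingQuot.mkAlgHom_rel k (GARel.rel_zero (k := k) (rel := rel) a b h)

theorem arr_mul_arr_of_ne {a b : Q.Arr} (h : Q.tgt a ≠ Q.src b) :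
    arr k Q rel a * arr k Q rel b = 0 := by
  have h1 := arr_mul_vtx k Q rel (Q.tgt a) a
  rw [if_pos rfl] at h1
  rw [← h1, mul_assoc, vtx_mul_arr, if_neg h, mul_zero]

/-- A subspace containing `1` and stable under right multiplication by the stationary paths and
the arrows is everything. -/
theorem mem_of_mul_mem {S : Submodule k (GA k Q rel)} (h1 : 1 ∈ S)
    (hv : ∀ x ∈ S, ∀ v, x * vtx k Q rel v ∈ S) (ha : ∀ x ∈ S, ∀ a, x * arr k Q rel a ∈ S)
    (x : GA k Q rel) : x ∈ S := by
  obtain ⟨z, rfl⟩ := RingQuot.mkAlgHom_surjective k (GARel k Q rel) x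
  have : ∀ y ∈ S, y * RingQuot.mkAlgHom k (GARel k Q rel) z ∈ S := by
    induction z using FreeAlgebra.induction with
    | grade0 r =>
      intro y hy
      rw [AlgHom.commutes, ← Algebra.commutes, ← Algebra.smul_def]
      exact S.smul_mem _ hy
    | grade1 g =>
      intro y hy
      rcases g with v | a
      · exact hv y hy v
      · exact ha y hy a
    | mul u v hu hv =>
      intro y hy
      rw [map_mul, ← mul_assoc]
      exact hv _ (hu _ hy)
    | add u v hu hv =>
      intro y hy
      rw [map_add, mul_add]
      exact S.add_mem (hu _ hy) (hv _ hy)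
  simpa using this 1 h1

theorem vtxHom_vtx (v w : Q.V) : vtxHom k Q rel v (vtx k Q rel w) = if w = v then 1 else 0 := by
  rw [vtx, ← AlgHom.coe_toRingHom, RingQuot.mkAlgHom_coe, vtxHom,
    RingQuot.lift_mkRingHom_apply]
  simp [vtxHomAux]

theorem vtxHom_arr (v : Q.V) (a : Q.Arr) : vtxHom k Q rel v (arr k Q rel a) = 0 := by
  rw [arr, ← AlgHom.coe_toRingHom, RingQuot.mkAlgHom_coe, vtxHom,
    RingQuot.lift_mkRingHom_apply]
  simp [vtxHomAux]

theorem vtxHom_algebraMap (v : Q.V) (r : k) :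
    vtxHom k Q rel v (algebraMap k (GA k Q rel) r) = r := by
  rw [← AlgHom.commutes (RingQuot.mkAlgHom k (GARel k Q rel)), ← AlgHom.coe_toRingHom,
    RingQuot.mkAlgHom_coe, vtxHom, RingQuot.lift_mkRingHom_apply]
  simp

theorem vtx_mem_mIdeal {v w : Q.V} (h : w ≠ v) : vtx k Q rel w ∈ mIdeal k Q rel v :=
  TwoSidedIdeal.subset_span (Or.inl ⟨w, h, rfl⟩)

theorem arr_mem_mIdeal (v : Q.V) (a : Q.Arr) : arr k Q rel a ∈ mIdeal k Q rel v := by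
  by_cases hs : Q.src a = v
  · by_cases ht : Q.tgt a = v
    · exact TwoSidedIdeal.subset_span (Or.inr ⟨a, hs, ht, rfl⟩)
    · have := TwoSidedIdeal.mul_mem_left _ (arr k Q rel a) _ (vtx_mem_mIdeal k Q rel ht)
      rwa [arr_mul_vtx, if_pos rfl] at this
  · have := TwoSidedIdeal.mul_mem_right _ _ (arr k Q rel a) (vtx_mem_mIdeal k Q rel hs)
    rwa [vtx_mul_arr, if_pos rfl] at this

theorem sub_vtxHom_mem_mIdeal (v : Q.V) (x : GA k Q rel) :
    x - algebraMap k _ (vtxHom k Q rel v x) ∈ mIdeal k Q rel v := by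
  have key : ∀ x y : GA k Q rel, x - algebraMap k _ (vtxHom k Q rel v x) ∈ mIdeal k Q rel v →
      y - algebraMap k _ (vtxHom k Q rel v y) ∈ mIdeal k Q rel v →
      x * y - algebraMap k _ (vtxHom k Q rel v (x * y)) ∈ mIdeal k Q rel v := by
    intro x y hx hy
    have : x * y - algebraMap k _ (vtxHom k Q rel v (x * y)) =
        (x - algebraMap k _ (vtxHom k Q rel v x)) * y +
          algebraMap k _ (vtxHom k Q rel v x) * (y - algebraMap k _ (vtxHom k Q rel v y)) := by
      rw [map_mul, map_mul]
      rw [sub_mul, mul_sub, sub_add_sub_cancel]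
    rw [this]
    exact TwoSidedIdeal.add_mem _ (TwoSidedIdeal.mul_mem_right _ _ _ hx)
      (TwoSidedIdeal.mul_mem_left _ _ _ hy)
  let S : Submodule k (GA k Q rel) :=
    { carrier := {x | x - algebraMap k _ (vtxHom k Q rel v x) ∈ mIdeal k Q rel v}
      add_mem' := fun {x y} hx hy => by
        change x + y - algebraMap k _ (vtxHom k Q rel v (x + y)) ∈ mIdeal k Q rel v
        rw [map_add, map_add, add_sub_add_comm]
        exact TwoSidedIdeal.add_mem _ hx hy
      zero_mem' := by
        change 0 - algebraMap k _ (vtxHom k Q rel v 0) ∈ mIdeal k Q rel v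
        rw [map_zero, map_zero, sub_zero]
        exact TwoSidedIdeal.zero_mem _
      smul_mem' := fun r x hx => by
        change r • x - algebraMap k _ (vtxHom k Q rel v (r • x)) ∈ mIdeal k Q rel v
        rw [Algebra.smul_def]
        refine key _ _ ?_ hx
        rw [vtxHom_algebraMap, sub_self]
        exact TwoSidedIdeal.zero_mem _ }
  refine mem_of_mul_mem k Q rel (S := S) ?_ (fun x hx w => key _ _ hx ?_)
    (fun x hx a => key _ _ hx ?_) x
  · change 1 - algebraMap k _ (vtxHom k Q rel v 1) ∈ mIdeal k Q rel v
    rw [map_one, map_one, sub_self]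
    exact TwoSidedIdeal.zero_mem _
  · rw [vtxHom_vtx]
    split_ifs with h
    · subst h
      rw [map_one, ← sum_vtx, ← Finset.sum_erase_add _ _ (Finset.mem_univ w), sub_add_cancel_right]
      refine TwoSidedIdeal.neg_mem _ (TwoSidedIdeal.finsetSum_mem _ _ _ fun u hu => ?_)
      exact vtx_mem_mIdeal k Q rel (Finset.ne_of_mem_erase hu)
    · rw [map_zero, sub_zero]
      exact vtx_mem_mIdeal k Q rel h
  · rw [vtxHom_arr, map_zero, sub_zero]
    exact arr_mem_mIdeal k Q rel v a

theorem mem_mIdeal_iff (v : Q.V) (x : GA k Q rel) :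
    x ∈ mIdeal k Q rel v ↔ vtxHom k Q rel v x = 0 := by
  constructor
  · intro hx
    rw [← TwoSidedIdeal.mem_ker]
    refine TwoSidedIdeal.span_le.2 ?_ hx
    rintro _ (⟨w, hw, rfl⟩ | ⟨a, -, -, rfl⟩)
    · exact (TwoSidedIdeal.mem_ker _).2 (by rw [vtxHom_vtx, if_neg hw])
    · exact (TwoSidedIdeal.mem_ker _).2 (vtxHom_arr k Q rel v a)
  · intro hx
    simpa [hx] using sub_vtxHom_mem_mIdeal k Q rel v x

theorem isPrimeTI_mIdeal (v : Q.V) : IsPrimeTI k Q rel (mIdeal k Q rel v) := by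
  refine ⟨fun htop => ?_, fun x y hxy => ?_⟩
  · have h1 : (1 : GA k Q rel) ∈ mIdeal k Q rel v := htop ▸ trivial
    rw [mem_mIdeal_iff, map_one] at h1
    exact one_ne_zero h1
  · have h1 := hxy 1
    simpa only [mem_mIdeal_iff, map_mul, map_one, mul_one, mul_eq_zero] using h1

variable {k Q rel}

/-- A prime ideal containing all the arrows is one of the ideals `𝔪_v`. -/
theorem exists_eq_mIdeal {P : TwoSidedIdeal (GA k Q rel)} (hP : IsPrimeTI k Q rel P)
    (harr : ∀ a, arr k Q rel a ∈ P) : ∃ v, P = mIdeal k Q rel v := by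
  have hv : ∃ v, vtx k Q rel v ∉ P := by
    by_contra! hall
    refine hP.1 ((TwoSidedIdeal.one_mem_iff P).1 ?_)
    rw [← sum_vtx]
    exact TwoSidedIdeal.finsetSum_mem _ _ _ fun v _ => hall v
  obtain ⟨v, hv⟩ := hv
  have hvtx : ∀ w, w ≠ v → vtx k Q rel w ∈ P := by
    intro w hw
    refine (hP.2 (vtx k Q rel v) (vtx k Q rel w) fun x => ?_).resolve_left hv
    let S : Submodule k (GA k Q rel) :=
      { carrier := {x | vtx k Q rel v * x - vtxHom k Q rel v x • vtx k Q rel v ∈ P}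
        add_mem' := fun {x y} hx hy => by
          change vtx k Q rel v * (x + y) - vtxHom k Q rel v (x + y) • vtx k Q rel v ∈ P
          rw [map_add, mul_add, add_smul, add_sub_add_comm]
          exact P.add_mem hx hy
        zero_mem' := by
          change vtx k Q rel v * 0 - vtxHom k Q rel v 0 • vtx k Q rel v ∈ P
          rw [map_zero, mul_zero, zero_smul, sub_zero]
          exact P.zero_mem
        smul_mem' := fun r x hx => by
          change vtx k Q rel v * (r • x) - vtxHom k Q rel v (r • x) • vtx k Q rel v ∈ P
          have := P.mul_mem_left (algebraMap k _ r) _ hx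
          rw [← Algebra.smul_def, smul_sub, smul_smul] at this
          rwa [Algebra.smul_def r x, map_mul, vtxHom_algebraMap, ← Algebra.smul_def,
            mul_smul_comm] }
    have step : ∀ x y, vtx k Q rel v * x - vtxHom k Q rel v x • vtx k Q rel v ∈ P →
        vtx k Q rel v * y - vtxHom k Q rel v y • vtx k Q rel v ∈ P →
        vtx k Q rel v * (x * y) - vtxHom k Q rel v (x * y) • vtx k Q rel v ∈ P := by
      intro x y hx hy
      have h1 := P.mul_mem_right _ y hx
      have h2 := P.mul_mem_left (algebraMap k _ (vtxHom k Q rel v x)) _ hy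
      have h3 := P.add_mem h1 h2
      rwa [← Algebra.smul_def, smul_sub, sub_mul, smul_mul_assoc, sub_add_sub_cancel, mul_assoc,
        smul_smul, ← map_mul] at h3
    have hx : vtx k Q rel v * x - vtxHom k Q rel v x • vtx k Q rel v ∈ P := by
      refine mem_of_mul_mem k Q rel (S := S) ?_ (fun x hx u => step _ _ hx ?_)
        (fun x hx a => step _ _ hx ?_) x
      · change vtx k Q rel v * 1 - vtxHom k Q rel v 1 • vtx k Q rel v ∈ P
        rw [map_one, one_smul, mul_one, sub_self]
        exact P.zero_mem
      · rw [vtxHom_vtx, vtx_mul_vtx]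
        by_cases h : u = v
        · rw [if_pos h.symm, if_pos h, one_smul, sub_self]
          exact P.zero_mem
        · rw [if_neg (Ne.symm h), if_neg h, zero_smul, sub_zero]
          exact P.zero_mem
      · rw [vtxHom_arr, zero_smul, sub_zero]
        exact P.mul_mem_left _ _ (harr a)
    have h1 := P.mul_mem_right _ (vtx k Q rel w) hx
    rwa [sub_mul, smul_mul_assoc, vtx_mul_vtx, if_neg hw.symm, smul_zero, sub_zero] at h1
  have hle : mIdeal k Q rel v ≤ P := by
    refine TwoSidedIdeal.span_le.2 ?_
    rintro _ (⟨w, hw, rfl⟩ | ⟨a, -, -, rfl⟩)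
    · exact hvtx w hw
    · exact harr a
  refine ⟨v, le_antisymm (fun x hx => ?_) hle⟩
  rw [mem_mIdeal_iff]
  by_contra h0
  refine hP.1 ((TwoSidedIdeal.one_mem_iff P).1 ?_)
  have h1 := P.sub_mem hx (hle (sub_vtxHom_mem_mIdeal k Q rel v x))
  rw [sub_sub_cancel] at h1
  have h2 := P.mul_mem_left (algebraMap k _ (vtxHom k Q rel v x)⁻¹) _ h1
  rwa [← map_mul, inv_mul_cancel₀ h0, map_one] at h2

end Relations

/-! ### The matrix representation attached to a cyclic ordering -/

namespace CyclicOrdering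

open Polynomial

section Paths

variable (k : Type) [Field k] {Q : Quiv} {rel : Q.Arr → Q.Arr → Prop} {n : ℕ}
  (o : CyclicOrdering rel n)

/-- the path of length `l` starting at the `i`-th arrow -/
def path (i l : ℕ) : GA k Q rel := wordEl k Q rel ((List.range l).map fun s => o.F (i + s))

theorem path_zero (i : ℕ) : o.path k i 0 = 1 := by simp [path, wordEl]

theorem path_succ (i l : ℕ) :
    o.path k i (l + 1) = o.path k i l * arr k Q rel (o.F (i + l)) := by
  simp [path, wordEl, List.range_succ]

theorem arr_eq_path (a : Q.Arr) : arr k Q rel a = o.path k (o.idx a) 1 := by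
  rw [path_succ, path_zero, one_mul, add_zero, o.F_idx]

theorem path_succ_mul_vtx (i l : ℕ) (v : Q.V) :
    o.path k i (l + 1) * vtx k Q rel v = 0 ∨
      o.path k i (l + 1) * vtx k Q rel v = o.path k i (l + 1) := by
  rw [path_succ, mul_assoc, arr_mul_vtx]
  split_ifs
  · exact Or.inr rfl
  · exact Or.inl (mul_zero _)

theorem path_succ_mul_arr (i l : ℕ) (a : Q.Arr) :
    o.path k i (l + 1) * arr k Q rel a = 0 ∨
      o.path k i (l + 1) * arr k Q rel a = o.path k i (l + 2) := by
  by_cases ha : a = o.F (i + (l + 1))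
  · right
    rw [ha, ← path_succ]
  · left
    rw [path_succ, mul_assoc]
    by_cases ht : Q.tgt (o.F (i + l)) = Q.src a
    · rw [arr_mul_arr_of_rel k Q rel (o.rel_of_ne _ _ ht ha), mul_zero]
    · rw [arr_mul_arr_of_ne k Q rel ht, mul_zero]

/-- `A` is spanned by the stationary paths and the paths of positive length. -/
theorem span_eq_top :
    Submodule.span k (Set.range (vtx k Q rel) ∪
      {x | ∃ i l, i < n ∧ x = o.path k i (l + 1)}) = ⊤ := by
  set S := Submodule.span k (Set.range (vtx k Q rel) ∪
    {x | ∃ i l, i < n ∧ x = o.path k i (l + 1)}) with hS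
  have hvtx : ∀ v, vtx k Q rel v ∈ S := fun v => Submodule.subset_span (Or.inl ⟨v, rfl⟩)
  have hpath : ∀ i l, i < n → o.path k i (l + 1) ∈ S := fun i l hi =>
    Submodule.subset_span (Or.inr ⟨i, l, hi, rfl⟩)
  have hmul : ∀ y : GA k Q rel,
      (∀ v, vtx k Q rel v * y ∈ S) → (∀ i l, i < n → o.path k i (l + 1) * y ∈ S) →
      ∀ x ∈ S, x * y ∈ S := by
    intro y h1 h2 x hx
    rw [hS] at hx
    induction hx using Submodule.span_induction with
    | mem x hx =>
      rcases hx with ⟨v, rfl⟩ | ⟨i, l, hi, rfl⟩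
      · exact h1 v
      · exact h2 i l hi
    | zero => rw [zero_mul]; exact S.zero_mem
    | add x z _ _ hx hz => rw [add_mul]; exact S.add_mem hx hz
    | smul r x _ hx => rw [smul_mul_assoc]; exact S.smul_mem r hx
  refine (Submodule.eq_top_iff' (p := S)).2 (mem_of_mul_mem k Q rel ?_
    (fun x hx v => hmul _ ?_ ?_ x hx) (fun x hx a => hmul _ ?_ ?_ x hx))
  · rw [← sum_vtx]
    exact S.sum_mem fun v _ => hvtx v
  · intro w
    rw [vtx_mul_vtx]
    split_ifs
    · exact hvtx w
    · exact S.zero_mem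
  · intro i l hi
    rcases o.path_succ_mul_vtx k i l v with h | h <;> rw [h]
    · exact S.zero_mem
    · exact hpath i l hi
  · intro w
    rw [vtx_mul_arr]
    split_ifs
    · rw [o.arr_eq_path k]
      exact hpath _ _ (o.idx_lt a)
    · exact S.zero_mem
  · intro i l hi
    rcases o.path_succ_mul_arr k i l a with h | h <;> rw [h]
    · exact S.zero_mem
    · exact hpath i (l + 1) hi

/-- the element of `A` at position `(i, j)`: the path from the `i`-th to the `j`-th arrow if
`i < j`, and, if `i = j`, a stationary path provided that the `i`-th arrow is the chosen one -/
def retractAux (i j : ℕ) : GA k Q rel :=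
  if i < j then o.path k i (j - i)
  else if j = i ∧ o.F i = o.out (Q.src (o.F i)) then vtx k Q rel (Q.src (o.F i)) else 0

/-- a linear left inverse of `rep` -/
def retract : Matrix (Fin n) (Fin n) k[X] →ₗ[k] GA k Q rel :=
  ∑ i : Fin n, ∑ r : Fin n,
    ((Polynomial.basisMonomials k).constr k fun q => o.retractAux k i (n * q + r)) ∘ₗ
      Matrix.entryLinearMap k k[X] i r

theorem constr_X_pow (f : ℕ → GA k Q rel) (q : ℕ) :
    (Polynomial.basisMonomials k).constr k f (X ^ q) = f q := by
  have h : (X ^ q : k[X]) = Polynomial.basisMonomials k q := by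
    rw [Polynomial.coe_basisMonomials, ← Polynomial.monomial_one_right_eq_X_pow]
  rw [h, Module.Basis.constr_basis]

theorem retract_single (i r : Fin n) (q : ℕ) :
    o.retract k (Matrix.single i r (X ^ q)) = o.retractAux k i (n * q + r) := by
  rw [retract, LinearMap.sum_apply, Finset.sum_eq_single i, LinearMap.sum_apply,
    Finset.sum_eq_single r]
  · rw [LinearMap.comp_apply, Matrix.entryLinearMap_apply, Matrix.single_apply_same, constr_X_pow]
  · intro s _ hs
    rw [LinearMap.comp_apply, Matrix.entryLinearMap_apply,
      Matrix.single_apply_of_col_ne _ _ hs.symm, map_zero]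
  · simp
  · intro j _ hj
    rw [LinearMap.sum_apply]
    refine Finset.sum_eq_zero fun s _ => ?_
    rw [LinearMap.comp_apply, Matrix.entryLinearMap_apply,
      Matrix.single_apply_of_row_ne hj.symm, map_zero]
  · simp

theorem src_F_idx_succ (a : Q.Arr) : Q.src (o.F (o.idx a + 1)) = Q.tgt a := by
  rw [← o.tgt_eq, o.F_idx]

end Paths

section Representation

variable (k : Type) [Field k] {Q : Quiv} {rel : Q.Arr → Q.Arr → Prop} {n : ℕ} [NeZero n]
  (o : CyclicOrdering rel n)

/-- the matrix `X ^ ((i + l) / n) E_{i, i + l}` representing the path of length `l` starting at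
the `i`-th arrow, for `i < n` and `1 ≤ l` -/
def pathMatrix (k : Type) [Field k] (n : ℕ) [NeZero n] (i l : ℕ) :
    Matrix (Fin n) (Fin n) k[X] :=
  Matrix.single (Fin.ofNat n i) (Fin.ofNat n (i + l)) (X ^ ((i + l) / n))

/-- the matrix representing the stationary path at `v` -/
def vtxMatrix (v : Q.V) : Matrix (Fin n) (Fin n) k[X] :=
  Matrix.diagonal fun i => if Q.src (o.F i) = v then 1 else 0

/-- the matrices representing the generators of `A` -/
def repAux : FreeAlgebra k (Q.V ⊕ Q.Arr) →ₐ[k] Matrix (Fin n) (Fin n) k[X] :=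
  FreeAlgebra.lift k (Sum.elim (o.vtxMatrix k) fun a => pathMatrix k n (o.idx a) 1)

theorem vtxMatrix_mul_pathMatrix (v : Q.V) (i l : ℕ) :
    o.vtxMatrix k v * pathMatrix k n i l =
      if Q.src (o.F i) = v then pathMatrix k n i l else 0 := by
  ext1 s t
  rw [vtxMatrix, pathMatrix, Matrix.diagonal_mul]
  by_cases hs : Fin.ofNat n i = s
  · rw [← hs, Fin.val_ofNat, o.F_mod]
    split_ifs <;> simp
  · rw [Matrix.single_apply_of_row_ne hs, mul_zero]
    split_ifs
    · rw [Matrix.single_apply_of_row_ne hs]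
    · rfl

theorem pathMatrix_mul_vtxMatrix (v : Q.V) (i l : ℕ) :
    pathMatrix k n i l * o.vtxMatrix k v =
      if Q.src (o.F (i + l)) = v then pathMatrix k n i l else 0 := by
  ext1 s t
  rw [vtxMatrix, pathMatrix, Matrix.mul_diagonal]
  by_cases ht : Fin.ofNat n (i + l) = t
  · rw [← ht, Fin.val_ofNat, o.F_mod]
    split_ifs <;> simp
  · rw [Matrix.single_apply_of_col_ne _ _ ht, zero_mul]
    split_ifs
    · rw [Matrix.single_apply_of_col_ne _ _ ht]
    · rfl

theorem ofNat_idx_ne {i : ℕ} {b : Q.Arr} (h : b ≠ o.F i) :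
    Fin.ofNat n i ≠ Fin.ofNat n (o.idx b) := by
  intro he
  have h1 := congrArg Fin.val he
  rw [Fin.val_ofNat, Fin.val_ofNat] at h1
  apply h
  rw [← o.F_mod, h1, o.F_mod, o.F_idx]

theorem repAux_rel : ∀ ⦃x y⦄, GARel k Q rel x y → o.repAux k x = o.repAux k y := by
  intro x y h
  cases h with
  | idem v =>
    simp only [repAux, map_mul, FreeAlgebra.lift_ι_apply, Sum.elim_inl, vtxMatrix,
      Matrix.diagonal_mul_diagonal]
    simp
  | orth v w hne =>
    simp only [repAux, map_mul, FreeAlgebra.lift_ι_apply, Sum.elim_inl, vtxMatrix,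
      Matrix.diagonal_mul_diagonal, map_zero]
    rw [← Matrix.diagonal_zero]
    congr 1
    ext1 i
    split_ifs with h1 h2 <;> first | exact absurd (h1.symm.trans h2) hne | simp
  | unit =>
    simp only [repAux, map_sum, FreeAlgebra.lift_ι_apply, Sum.elim_inl, vtxMatrix, map_one]
    ext1 i j
    rw [Matrix.sum_apply]
    by_cases hij : i = j
    · subst hij
      simp
    · simp [hij]
  | src_mul a =>
    simp only [repAux, map_mul, FreeAlgebra.lift_ι_apply, Sum.elim_inl, Sum.elim_inr,
      vtxMatrix_mul_pathMatrix, o.F_idx, if_true]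
  | mul_tgt a =>
    simp only [repAux, map_mul, FreeAlgebra.lift_ι_apply, Sum.elim_inl, Sum.elim_inr,
      pathMatrix_mul_vtxMatrix, o.src_F_idx_succ, if_true]
  | src_zero v a hv =>
    simp only [repAux, map_mul, FreeAlgebra.lift_ι_apply, Sum.elim_inl, Sum.elim_inr,
      vtxMatrix_mul_pathMatrix, o.F_idx, if_neg hv.symm, map_zero]
  | tgt_zero v a hv =>
    simp only [repAux, map_mul, FreeAlgebra.lift_ι_apply, Sum.elim_inl, Sum.elim_inr,
      pathMatrix_mul_vtxMatrix, o.src_F_idx_succ, if_neg hv.symm, map_zero]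
  | rel_zero a b hab =>
    simp only [repAux, map_mul, FreeAlgebra.lift_ι_apply, Sum.elim_inr, map_zero, pathMatrix]
    apply Matrix.single_mul_single_of_ne
    apply o.ofNat_idx_ne
    rintro rfl
    have := o.not_rel (o.idx a)
    rw [o.F_idx] at this
    exact this hab

/-- the representation of `A` by matrices over `k[X]` -/
def rep : GA k Q rel →ₐ[k] Matrix (Fin n) (Fin n) k[X] :=
  RingQuot.liftAlgHom k ⟨o.repAux k, o.repAux_rel k⟩

theorem rep_vtx (v : Q.V) : o.rep k (vtx k Q rel v) = o.vtxMatrix k v := by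
  rw [rep, vtx, RingQuot.liftAlgHom_mkAlgHom_apply, repAux, FreeAlgebra.lift_ι_apply,
    Sum.elim_inl]

theorem rep_arr (a : Q.Arr) : o.rep k (arr k Q rel a) = pathMatrix k n (o.idx a) 1 := by
  rw [rep, arr, RingQuot.liftAlgHom_mkAlgHom_apply, repAux, FreeAlgebra.lift_ι_apply,
    Sum.elim_inr]

theorem rep_path {i : ℕ} (hi : i < n) (l : ℕ) :
    o.rep k (o.path k i (l + 1)) = pathMatrix k n i (l + 1) := by
  induction l with
  | zero =>
    rw [path_succ, path_zero, one_mul, rep_arr, o.idx_F, add_zero, Nat.mod_eq_of_lt hi]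
  | succ l ih =>
    rw [path_succ, map_mul, ih, rep_arr, o.idx_F, pathMatrix, pathMatrix, pathMatrix]
    have h1 : Fin.ofNat n ((i + (l + 1)) % n) = Fin.ofNat n (i + (l + 1)) := by
      ext; simp
    have h2 : Fin.ofNat n ((i + (l + 1)) % n + 1) = Fin.ofNat n (i + (l + 1 + 1)) := by
      ext; simp [add_assoc]
    rw [h1, h2, Matrix.single_mul_single_same, ← pow_add]
    congr 2
    conv_rhs => rw [← add_assoc, ← Nat.div_add_mod (i + (l + 1)) n, add_assoc,
      Nat.mul_add_div (NeZero.pos n)]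

theorem retract_rep (x : GA k Q rel) : o.retract k (o.rep k x) = x := by
  have key : o.retract k ∘ₗ (o.rep k).toLinearMap = LinearMap.id := by
    refine LinearMap.ext_on (o.span_eq_top k) ?_
    rintro _ (⟨v, rfl⟩ | ⟨i, l, hi, rfl⟩)
    · rw [LinearMap.comp_apply, AlgHom.toLinearMap_apply, rep_vtx, vtxMatrix,
        ← Matrix.sum_single_eq_diagonal, map_sum, LinearMap.id_apply,
        Finset.sum_eq_single ⟨o.idx (o.out v), o.idx_lt _⟩]
      · rw [o.F_idx, if_pos (o.src_out v)]
        have := o.retract_single k ⟨o.idx (o.out v), o.idx_lt _⟩ ⟨o.idx (o.out v), o.idx_lt _⟩ 0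
        rw [pow_zero] at this
        rw [this]
        simp [retractAux, o.F_idx, o.src_out]
      · intro j _ hj
        split_ifs with h
        · have := o.retract_single k j j 0
          rw [pow_zero] at this
          rw [this, retractAux, if_neg (by simp), if_neg]
          rintro ⟨-, h1⟩
          apply hj
          ext
          rw [← Nat.mod_eq_of_lt j.2, ← o.idx_F, h1, h]
        · rw [Matrix.single_zero, map_zero]
      · simp
    · rw [LinearMap.comp_apply, AlgHom.toLinearMap_apply, o.rep_path k hi, pathMatrix,
        retract_single, LinearMap.id_apply, Fin.val_ofNat, Fin.val_ofNat, Nat.mod_eq_of_lt hi,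
        Nat.div_add_mod, retractAux, if_pos (by omega), Nat.add_sub_cancel_left]
  exact LinearMap.congr_fun key x

theorem rep_injective : Function.Injective (o.rep k) :=
  Function.LeftInverse.injective (o.retract_rep k)

theorem exists_rep_eq (M : Matrix (Fin n) (Fin n) k[X]) :
    ∃ y, o.rep k y = (X : k[X]) • M := by
  have hsingle : ∀ (i r : Fin n) (f : k[X]),
      ∃ y, o.rep k y = (X : k[X]) • Matrix.single i r f := by
    intro i r f
    induction f using Polynomial.induction_on' with
    | add f g hf hg =>
      obtain ⟨y, hy⟩ := hf
      obtain ⟨z, hz⟩ := hg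
      exact ⟨y + z, by rw [map_add, hy, hz, Matrix.single_add, smul_add]⟩
    | monomial q c =>
      have hl : ∃ l, i + (l + 1) = n * (q + 1) + r := by
        have h1 : n * (q + 1) = n * q + n := by ring
        have h2 := i.2
        exact ⟨n * (q + 1) + r - i - 1, by omega⟩
      obtain ⟨l, hl⟩ := hl
      refine ⟨c • o.path k i (l + 1), ?_⟩
      have h1 : Fin.ofNat n (i : ℕ) = i := by ext; simp
      have h2 : Fin.ofNat n (n * (q + 1) + r) = r := by
        ext; simp [Nat.mod_eq_of_lt r.2]
      have h3 : (n * (q + 1) + r) / n = q + 1 := by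
        rw [Nat.mul_add_div (NeZero.pos n), Nat.div_eq_of_lt r.2, add_zero]
      rw [map_smul, o.rep_path k i.2, pathMatrix, hl, h1, h2, h3, Matrix.smul_single,
        Matrix.smul_single, ← C_mul_X_pow_eq_monomial, smul_eq_C_mul, smul_eq_mul]
      congr 1
      ring
  choose y hy using hsingle
  refine ⟨∑ i, ∑ r, y i r (M i r), ?_⟩
  simp only [map_sum, hy]
  conv_rhs => rw [Matrix.matrix_eq_sum_single M]
  simp only [Finset.smul_sum]

/-- The image of `A` is upper triangular modulo `X`. -/
theorem X_dvd_rep_apply (x : GA k Q rel) {i j : Fin n} (hij : j < i) :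
    X ∣ o.rep k x i j := by
  have hx : x ∈ Submodule.span k (Set.range (vtx k Q rel) ∪
      {x | ∃ i l, i < n ∧ x = o.path k i (l + 1)}) := o.span_eq_top k ▸ trivial
  induction hx using Submodule.span_induction with
  | mem x hx =>
    rcases hx with ⟨v, rfl⟩ | ⟨s, l, hs, rfl⟩
    · rw [rep_vtx, vtxMatrix, Matrix.diagonal_apply_ne _ hij.ne']
      exact dvd_zero _
    · rw [o.rep_path k hs, pathMatrix, Matrix.single_apply]
      split_ifs with h
      · obtain ⟨rfl, rfl⟩ := h
        refine dvd_pow_self _ fun h0 => ?_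
        rw [Fin.lt_def, Fin.val_ofNat, Fin.val_ofNat, Nat.mod_eq_of_lt hs] at hij
        have := Nat.div_add_mod (s + (l + 1)) n
        rw [h0, mul_zero] at this
        omega
      · exact dvd_zero _
  | zero => simp
  | add x y _ _ hx hy => rw [map_add, Matrix.add_apply]; exact dvd_add hx hy
  | smul r x _ hx =>
    rw [map_smul, Matrix.smul_apply, smul_eq_C_mul]
    exact Dvd.dvd.mul_left hx _

theorem isMatrixOrder {m : GA k Q rel} (hm : m = ∑ i ∈ Finset.range n, o.path k i n) :
    IsMatrixOrder (o.rep k) m where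
  injective := o.rep_injective k
  exists_preimage := o.exists_rep_eq k
  map_eq := by
    rw [hm, map_sum, Finset.sum_range, Algebra.algebraMap_eq_smul_one,
      Matrix.smul_one_eq_diagonal, ← Matrix.sum_single_eq_diagonal]
    refine Finset.sum_congr rfl fun i _ => ?_
    obtain ⟨l, hl⟩ := Nat.exists_eq_succ_of_ne_zero (NeZero.ne n)
    have h1 := o.rep_path k i.2 l
    rw [← Nat.succ_eq_add_one, ← hl] at h1
    rw [h1, pathMatrix, Nat.add_div_right _ (NeZero.pos n), Nat.div_eq_of_lt i.2]
    have h2 : Fin.ofNat n (i : ℕ) = i := by ext; simp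
    have h3 : Fin.ofNat n (i + n : ℕ) = i := by ext; simp [Nat.mod_eq_of_lt i.2]
    rw [h2, h3, zero_add, pow_one]

variable {k} in
theorem arr_mem_of_isPrimeTI {m : GA k Q rel} (hm : IsMatrixOrder (o.rep k) m)
    {P : TwoSidedIdeal (GA k Q rel)} (hP : IsPrimeTI k Q rel P) (hmP : m ∈ P) (a : Q.Arr) :
    arr k Q rel a ∈ P := by
  refine or_self_iff.1 (hP.2 _ _ fun x => hm.mem_of_X_dvd hP.2 hmP fun i j => ?_)
  rw [map_mul, map_mul, rep_arr, pathMatrix, Matrix.single_mul_mul_single, Matrix.single_apply]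
  split_ifs
  · by_cases h : o.idx a + 1 < n
    · refine Dvd.dvd.mul_right (Dvd.dvd.mul_left (o.X_dvd_rep_apply k x ?_) _) _
      rw [Fin.lt_def, Fin.val_ofNat, Fin.val_ofNat, Nat.mod_eq_of_lt h,
        Nat.mod_eq_of_lt (o.idx_lt a)]
      exact Nat.lt_succ_self _
    · have : o.idx a + 1 = n := le_antisymm (o.idx_lt a) (not_lt.1 h)
      rw [this, Nat.div_self (NeZero.pos n), pow_one]
      exact dvd_mul_left _ _
  · exact dvd_zero _

end Representation

end CyclicOrdering

/-! ### Primitive cycles through all the arrows -/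

section PrimitiveCycle

theorem map_range_mul_eq_flatten_replicate {α : Type*} {F : ℕ → α} {g : ℕ}
    (hg : Function.Periodic F g) (q : ℕ) :
    (List.range (q * g)).map F = (List.replicate q ((List.range g).map F)).flatten := by
  induction q with
  | zero => simp
  | succ q ih =>
    rw [Nat.succ_mul, Nat.add_comm, List.range_add, List.map_append, List.replicate_succ,
      List.flatten_cons, ← ih, List.map_map]
    congr 2
    funext x
    rw [Function.comp_apply, Nat.add_comm, hg]

/-- If a periodic sequence in which each term determines the next one is not a proper power over
a period, then its terms over that period are distinct. -/
theorem eq_of_primitive {α : Type*} {F : ℕ → α} {n : ℕ} (hper : Function.Periodic F n)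
    (hdet : ∀ i j, F i = F j → F (i + 1) = F (j + 1))
    (hprim : ∀ (l : List α) (q : ℕ), 2 ≤ q →
      (List.range n).map F ≠ (List.replicate q l).flatten) :
    ∀ i j, i < n → j < n → F i = F j → i = j := by
  have key : ∀ i j, i < j → j < n → F i ≠ F j := by
    intro i j hij hj hF
    have hshift : ∀ s, F (i + s) = F (j + s) := fun s => by
      induction s with
      | zero => exact hF
      | succ s ih => exact hdet _ _ ih
    have hd : Function.Periodic F (j - i) := by
      intro x
      have hni : i ≤ i * n := Nat.le_mul_of_pos_right i (by omega)
      rw [← hper.nat_mul i (x + (j - i)), ← hper.nat_mul i x]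
      simp only [Nat.cast_id]
      have h1 : x + (j - i) + i * n = j + (x + i * n - i) := by omega
      have h2 : x + i * n = i + (x + i * n - i) := by omega
      rw [h1, h2, Nat.add_sub_cancel_left]
      exact (hshift _).symm
    classical
    have hex : ∃ g, 0 < g ∧ Function.Periodic F g := ⟨j - i, by omega, hd⟩
    obtain ⟨hg0, hg⟩ := Nat.find_spec hex
    have hmin : ∀ g', 0 < g' → Function.Periodic F g' → Nat.find hex ≤ g' := fun g' h0 h =>
      Nat.find_min' hex ⟨h0, h⟩
    generalize Nat.find hex = g at hg0 hg hmin
    have hmod : Function.Periodic F (n % g) := by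
      intro x
      rw [← hg.nat_mul (n / g) (x + n % g), Nat.cast_id, Nat.add_assoc, Nat.mod_add_div', hper]
    have hdvd : n % g = 0 := by
      by_contra h0
      exact absurd (hmin _ (Nat.pos_of_ne_zero h0) hmod) (not_le.2 (Nat.mod_lt _ hg0))
    have hgn : g < n := lt_of_le_of_lt (hmin _ (by omega) hd) (by omega)
    obtain ⟨q, rfl⟩ := Nat.dvd_of_mod_eq_zero hdvd
    refine hprim ((List.range g).map F) q ?_ ?_
    · by_contra hq
      have : g * q ≤ g * 1 := Nat.mul_le_mul_left g (by omega)
      omega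
    · rw [Nat.mul_comm]
      exact map_range_mul_eq_flatten_replicate hg q
  intro i j hi hj hF
  rcases lt_trichotomy i j with h | h | h
  · exact absurd hF (key i j h hj)
  · exact h
  · exact absurd hF.symm (key j i h hi)

variable {Q : Quiv} {rel : Q.Arr → Q.Arr → Prop} {w : List Q.Arr}

/-- the periodic extension of a word -/
def cyclicExt (w : List Q.Arr) (i : ℕ) : Q.Arr := w.getD (i % w.length) (Classical.arbitrary _)

theorem cyclicExt_of_lt {i : ℕ} (hi : i < w.length) : cyclicExt w i = w[i] := by
  rw [cyclicExt, Nat.mod_eq_of_lt hi, List.getD_eq_getElem _ _ hi]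

theorem cyclicExt_periodic (w : List Q.Arr) : Function.Periodic (cyclicExt w) w.length := by
  intro i
  rw [cyclicExt, cyclicExt, Nat.add_mod_right]

theorem map_range_cyclicExt (w : List Q.Arr) :
    (List.range w.length).map (cyclicExt w) = w := by
  refine List.ext_getElem (by simp) fun i h1 h2 => ?_
  rw [List.getElem_map, List.getElem_range, cyclicExt_of_lt h2]

theorem cyclicExt_step (hc : w ≠ []) (hcc : AllowedWord rel (w ++ w)) (i : ℕ) :
    Q.tgt (cyclicExt w i) = Q.src (cyclicExt w (i + 1)) ∧
      ¬ rel (cyclicExt w i) (cyclicExt w (i + 1)) := by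
  have hn : 0 < w.length := List.length_pos_iff.2 hc
  have hlt : i % w.length < w.length := Nat.mod_lt _ hn
  have h := List.isChain_iff_getElem.1 hcc (i % w.length)
    (by rw [List.length_append]; omega)
  have h1 : cyclicExt w (i + 1) = cyclicExt w (i % w.length + 1) := by
    rw [cyclicExt, cyclicExt, Nat.mod_add_mod]
  rw [h1, cyclicExt, List.getD_eq_getElem _ _ hlt]
  rw [List.getElem_append_left hlt] at h
  by_cases hi : i % w.length + 1 < w.length
  · rw [cyclicExt_of_lt hi]
    rwa [List.getElem_append_left hi] at h
  · have h2 : i % w.length + 1 = w.length := by omega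
    rw [List.getElem_append_right (by omega)] at h
    rw [h2, cyclicExt, List.getD_eq_getElem _ _ (by rwa [Nat.mod_self])]
    simpa only [h2, Nat.mod_self, Nat.sub_self] using h

/-- A primitive cycle with nonzero square through all the arrows orders them cyclically. -/
def cyclicOrderingOf (hgentle : IsGentleRel Q rel) (hc : PrimCycleSq rel w)
    (hall : ∀ a, a ∈ w) : CyclicOrdering rel w.length where
  F := cyclicExt w
  periodic := cyclicExt_periodic w
  tgt_eq i := (cyclicExt_step hc.1 hc.2.1 i).1
  not_rel i := (cyclicExt_step hc.1 hc.2.1 i).2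
  rel_of_ne i b ht hb := by
    obtain ⟨h1, h2⟩ := cyclicExt_step hc.1 hc.2.1 i
    rcases hgentle.cond_iii _ _ _ hb ht h1 with h | h
    · exact h.1
    · exact absurd h.1 h2
  surj a := by
    obtain ⟨i, hi, rfl⟩ := List.getElem_of_mem (hall a)
    exact ⟨i, hi, cyclicExt_of_lt hi⟩
  injOn := by
    refine eq_of_primitive (cyclicExt_periodic w) (fun i j hij => ?_) fun l q hq => ?_
    · obtain ⟨h1, h2⟩ := cyclicExt_step hc.1 hc.2.1 i
      obtain ⟨h3, h4⟩ := cyclicExt_step hc.1 hc.2.1 j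
      by_contra hne
      rw [hij] at h1 h2
      rcases hgentle.cond_iii _ _ _ hne h1 h3 with h | h
      · exact h2 h.1
      · exact h4 h.1
    · rw [map_range_cyclicExt]
      exact hc.2.2.2 l q hq

theorem rotTo_getElem (hc : w.Nodup) {i : ℕ} (hi : i < w.length) :
    rotTo w w[i] = (List.range w.length).map fun s => cyclicExt w (i + s) := by
  have hidx : w.findIdx (fun b => !(b != w[i])) = i := by
    rw [List.findIdx_eq hi]
    refine ⟨by simp, fun j hj => ?_⟩
    have : w[j] ≠ w[i] := fun h => hj.ne ((hc.getElem_inj_iff).1 h)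
    simpa using this
  rw [rotTo, List.dropWhile_eq_drop_findIdx_not, List.takeWhile_eq_take_findIdx_not, hidx,
    ← List.rotate_eq_drop_append_take hi.le]
  refine List.ext_getElem (by simp) fun j h1 h2 => ?_
  rw [List.getElem_rotate, List.getElem_map, List.getElem_range, cyclicExt,
    List.getD_eq_getElem _ _ (Nat.mod_lt _ (by omega))]
  simp only [Nat.add_comm]

theorem mEl_eq_sum_path (k : Type) [Field k] (hgentle : IsGentleRel Q rel)
    (hc : PrimCycleSq rel w) (hall : ∀ a, a ∈ w) :
    mEl k Q rel w =
      ∑ i ∈ Finset.range w.length, (cyclicOrderingOf hgentle hc hall).path k i w.length := by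
  have hnodup : w.Nodup := by
    rw [List.nodup_iff_injective_get]
    intro i j hij
    ext
    refine (cyclicOrderingOf hgentle hc hall).injOn i j i.2 j.2 ?_
    change cyclicExt w i = cyclicExt w j
    rw [cyclicExt_of_lt i.2, cyclicExt_of_lt j.2]
    exact hij
  rw [mEl, ← Fin.sum_univ_fun_getElem w (fun a => wordEl k Q rel (rotTo w a)), Finset.sum_range]
  exact Finset.sum_congr rfl fun i _ => congrArg _ (rotTo_getElem hnodup i.2)

end PrimitiveCycle

/-- **Proposition 3.2 (prop:A'primes).** Let `A = kQ/I` be a locally gentle algebra with a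
unique maximal path `γ`, which is infinite (represented by the primitive cycle `c`
containing every arrow).  The prime (two-sided) ideals of `A` are exactly: (1) the zero
ideal; (2) the ideal `𝔪_v` for each vertex `v`; (3) the ideal `⟨p(m_γ)⟩` for each
irreducible polynomial `p(t) ∈ k[t]` with `deg p ≥ 1` and `p(0) ≠ 0`. -/
theorem statement6 (k : Type) [Field k] [CharZero k] (Q : Quiv)
    (rel : Q.Arr → Q.Arr → Prop) (hgentle : IsGentleRel Q rel)
    (hloc : ¬ FiniteDimensional k (GA k Q rel))
    (c : List Q.Arr) (hc : PrimCycleSq rel c) (hall : ∀ a : Q.Arr, a ∈ c) :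
    ∀ P : TwoSidedIdeal (GA k Q rel),
      IsPrimeTI k Q rel P ↔
        P = ⊥ ∨
        (∃ v : Q.V, P = mIdeal k Q rel v) ∨
        (∃ p : Polynomial k, Irreducible p ∧ 1 ≤ p.natDegree ∧ p.coeff 0 ≠ 0 ∧
          P = TwoSidedIdeal.span {polyEval k Q rel p (mEl k Q rel c)}) := by
  have : NeZero c.length := ⟨(List.length_pos_iff.2 hc.1).ne'⟩
  let o := cyclicOrderingOf hgentle hc hall
  have ho : IsMatrixOrder (o.rep k) (mEl k Q rel c) :=
    o.isMatrixOrder k (mEl_eq_sum_path k hgentle hc hall)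
  intro P
  constructor
  · intro hP
    by_cases hbot : P = ⊥
    · exact Or.inl hbot
    by_cases hm : mEl k Q rel c ∈ P
    · exact Or.inr (Or.inl (exists_eq_mIdeal hP (o.arr_mem_of_isPrimeTI ho hP hm)))
    · exact Or.inr (Or.inr (ho.exists_eq_span_aeval hP.1 hP.2 hm hbot))
  · rintro (rfl | ⟨v, rfl⟩ | ⟨p, hirr, -, hp, rfl⟩)
    · exact ⟨IsMatrixOrder.bot_ne_top (o.rep k), fun x y => ho.bot_prime⟩
    · exact isPrimeTI_mIdeal k Q rel v
    · exact ⟨ho.span_aeval_ne_top hirr hp, fun x y => ho.span_aeval_prime hirr hp⟩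

end LocGentle
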